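/- Let S ⊆ V be a discrete subsemigroup of a finite-dimensional real vector space (meaning the group ℤS generated by S is discrete), and let f : S → ℝ be subadditive: f(u+v) ≤ f(u) + f(v). Suppose x lies in the relative interior of the closed convex cone generated by S. Then for any sequence ε_k > 0 with ε_k → 0 and u_k ∈ S with ε_k u_k → x, the limit lim_k ε_k f(u_k) exists in ℝ ∪ {-∞} and depends only on x. -/

import Mathlib

open Filter

/-- A positive integral combination of elements of `S` lies in `S`, and a subadditive function
is bounded on it by the corresponding combination of its values. -/
theorem AddSubsemigroup.sum_nsmul_mem_and_le {V ι : Type*} [AddCommMonoid V] [Fintype ι]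
    [Nonempty ι] (S : AddSubsemigroup V) (f : V → ℝ)
    (hsub : ∀ u ∈ S, ∀ v ∈ S, f (u + v) ≤ f u + f v)
    (s : ι → V) (hs : ∀ i, s i ∈ S) (k : ι → ℕ) (hk : ∀ i, 1 ≤ k i) :
    ∑ i, k i • s i ∈ S ∧ f (∑ i, k i • s i) ≤ ∑ i, k i * f (s i) := by
  have hadd : ∀ a b : V × ℝ, (a.1 ∈ S ∧ f a.1 ≤ a.2) → (b.1 ∈ S ∧ f b.1 ≤ b.2) →
      ((a + b).1 ∈ S ∧ f (a + b).1 ≤ (a + b).2) := fun a b ha hb =>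
    ⟨S.add_mem ha.1 hb.1, (hsub _ ha.1 _ hb.1).trans (add_le_add ha.2 hb.2)⟩
  have hsmul : ∀ i, k i • s i ∈ S ∧ f (k i • s i) ≤ k i * f (s i) := by
    intro i
    induction k i, hk i using Nat.le_induction with
    | base => simpa using hs i
    | succ n _ ih =>
      have := hadd (n • s i, n * f (s i)) (s i, f (s i)) ih ⟨hs i, le_rfl⟩
      simpa [succ_nsmul, add_mul] using this
  have := Finset.sum_induction_nonempty (s := Finset.univ)
    (fun i => ((k i • s i, k i * f (s i)) : V × ℝ)) (fun a => a.1 ∈ S ∧ f a.1 ≤ a.2) hadd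
    Finset.univ_nonempty (fun i _ => hsmul i)
  simpa [Prod.fst_sum, Prod.snd_sum] using this

theorem AddSubsemigroup.nsmul_add_le {V : Type*} [AddCommMonoid V] (S : AddSubsemigroup V)
    (f : V → ℝ) (hsub : ∀ u ∈ S, ∀ v ∈ S, f (u + v) ≤ f u + f v)
    {v w : V} (hv : v ∈ S) (hw : w ∈ S) (m : ℕ) :
    f (m • v + w) ≤ m * f v + f w := by
  suffices m • v + w ∈ S ∧ f (m • v + w) ≤ m * f v + f w from this.2
  induction m with
  | zero => simpa using hw
  | succ m ih =>
    have h : (m + 1) • v + w = v + (m • v + w) := by rw [succ_nsmul, add_comm _ v, add_assoc]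
    rw [h]
    refine ⟨S.add_mem hv ih.1, (hsub _ hv _ ih.1).trans ?_⟩
    push_cast
    linarith [ih.2]

/-- Vectors in the span of a finite family can be written with linearly bounded coefficients. -/
theorem exists_bounded_coefficients {V ι : Type*} [NormedAddCommGroup V] [NormedSpace ℝ V]
    [FiniteDimensional ℝ V] [Fintype ι] (s : ι → V) :
    ∃ M > 0, ∀ v ∈ Submodule.span ℝ (Set.range s),
      ∃ d : ι → ℝ, ∑ i, d i • s i = v ∧ ∀ i, |d i| ≤ M * ‖v‖ := by
  obtain ⟨g, hg⟩ := LinearMap.exists_rightInverse_of_surjective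
    (Fintype.linearCombination ℝ s).rangeRestrict (LinearMap.range_rangeRestrict _)
  refine ⟨‖LinearMap.toContinuousLinearMap g‖ + 1, by positivity, fun v hv => ?_⟩
  rw [← Fintype.range_linearCombination] at hv
  refine ⟨g ⟨v, hv⟩, ?_, fun i => ?_⟩
  · have := congrArg Subtype.val (LinearMap.congr_fun hg ⟨v, hv⟩)
    simpa [Fintype.linearCombination_apply] using this
  · calc |g ⟨v, hv⟩ i| ≤ ‖g ⟨v, hv⟩‖ := norm_le_pi_norm (g ⟨v, hv⟩) i
      _ ≤ ‖LinearMap.toContinuousLinearMap g‖ * ‖v‖ :=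
        (LinearMap.toContinuousLinearMap g).le_opNorm ⟨v, hv⟩
      _ ≤ _ := by gcongr; linarith

/-- Lattice points in a bounded region have uniformly bounded integral coefficients. -/
theorem exists_bounded_int_coefficients {V ι : Type*} [NormedAddCommGroup V] [NormedSpace ℝ V]
    [FiniteDimensional ℝ V] [Fintype ι] (s : ι → V)
    [DiscreteTopology (Submodule.span ℤ (Set.range s))] (B : ℝ) :
    ∃ N : ℕ, ∀ v ∈ Submodule.span ℤ (Set.range s), ‖v‖ ≤ B →
      ∃ n : ι → ℤ, ∑ i, n i • s i = v ∧ ∀ i, |n i| ≤ N := by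
  have hfin : (Metric.closedBall (0 : V) B ∩ (Submodule.span ℤ (Set.range s) : Set V)).Finite := by
    have : ProperSpace V := FiniteDimensional.proper ℝ V
    refine Metric.finite_isBounded_inter_isClosed DiscreteTopology.isDiscrete
      Metric.isBounded_closedBall ?_
    have : DiscreteTopology (Submodule.span ℤ (Set.range s)).toAddSubgroup := ‹_›
    exact AddSubgroup.isClosed_of_discrete (H := (Submodule.span ℤ (Set.range s)).toAddSubgroup)
  have hcoef : ∀ v : V, ∃ n : ι → ℤ, v ∈ Submodule.span ℤ (Set.range s) → ∑ i, n i • s i = v := by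
    intro v
    by_cases hv : v ∈ Submodule.span ℤ (Set.range s)
    · obtain ⟨n, hn⟩ := (Submodule.mem_span_range_iff_exists_fun ℤ).1 hv
      exact ⟨n, fun _ => hn⟩
    · exact ⟨0, fun h => absurd h hv⟩
  choose n hn using hcoef
  refine ⟨∑ v ∈ hfin.toFinset, ∑ i, (n v i).natAbs, fun v hv hB => ⟨n v, hn v hv, fun i => ?_⟩⟩
  have hmem : v ∈ hfin.toFinset := by simpa using ⟨hB, hv⟩
  have h1 : (n v i).natAbs ≤ ∑ i, (n v i).natAbs :=
    Finset.single_le_sum (f := fun i => (n v i).natAbs) (fun _ _ => Nat.zero_le _)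
      (Finset.mem_univ i)
  have h2 : ∑ i, (n v i).natAbs ≤ ∑ v ∈ hfin.toFinset, ∑ i, (n v i).natAbs :=
    Finset.single_le_sum (f := fun v => ∑ i, (n v i).natAbs) (fun _ _ => Nat.zero_le _) hmem
  rw [Int.abs_eq_natAbs]
  exact_mod_cast h1.trans h2

/-- Far lattice points close to the ray through a positive combination `∑ i, p i • s i` of
generators lie in `S`, and `f` grows at most linearly on them. -/
theorem exists_mem_and_le_of_near_ray {V ι : Type*} [NormedAddCommGroup V] [NormedSpace ℝ V]
    [FiniteDimensional ℝ V] [Fintype ι] [Nonempty ι] (S : AddSubsemigroup V)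
    (f : V → ℝ) (hsub : ∀ u ∈ S, ∀ v ∈ S, f (u + v) ≤ f u + f v)
    (s : ι → V) (hs : ∀ i, s i ∈ S) [DiscreteTopology (Submodule.span ℤ (Set.range s))]
    (p : ι → ℝ) (hp : ∀ i, 0 < p i) :
    ∃ r > 0, ∃ A T : ℝ, ∀ w ∈ Submodule.span ℤ (Set.range s), ∀ t ≥ T,
      ‖w - t • ∑ i, p i • s i‖ ≤ r * t → w ∈ S ∧ f w ≤ A * t := by
  obtain ⟨M, hM, hcoef⟩ := exists_bounded_coefficients s
  obtain ⟨N, hN⟩ := exists_bounded_int_coefficients s (∑ i, ‖s i‖)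
  obtain ⟨i₀, hi₀⟩ := Finite.exists_min p
  set P := ∑ i, p i
  have hpP : ∀ i, p i ≤ P := fun i =>
    Finset.single_le_sum (fun j _ => (hp j).le) (Finset.mem_univ i)
  have hp₀ := hp i₀
  refine ⟨p i₀ / (2 * M), by positivity, (2 * P + N) * ∑ i, |f (s i)|,
    2 * (N + 2) / p i₀ + 1, fun w hw t ht hwt => ?_⟩
  have ht1 : 1 ≤ t := le_trans (le_add_of_nonneg_left (by positivity)) ht
  have htN : N + 2 ≤ p i₀ * t / 2 := by
    have : 2 * (N + 2) / p i₀ ≤ t := by linarith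
    rw [div_le_iff₀ hp₀] at this
    linarith
  have hspan : ∀ v ∈ Submodule.span ℤ (Set.range s), v ∈ Submodule.span ℝ (Set.range s) :=
    fun v hv => Submodule.span_le_restrictScalars ℤ ℝ _ hv
  have hsmem : ∀ i, s i ∈ Submodule.span ℤ (Set.range s) := fun i =>
    Submodule.subset_span (Set.mem_range_self i)
  obtain ⟨d, hd, hdb⟩ := hcoef (w - t • ∑ i, p i • s i) (Submodule.sub_mem _ (hspan w hw)
    (Submodule.smul_mem _ _ (Submodule.sum_mem _ fun i _ =>
      Submodule.smul_mem _ _ (hspan _ (hsmem i)))))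
  have hdb' : ∀ i, |d i| ≤ p i₀ * t / 2 := fun i => (hdb i).trans <| by
    calc M * ‖w - t • ∑ i, p i • s i‖ ≤ M * (p i₀ / (2 * M) * t) := by gcongr
      _ = p i₀ * t / 2 := by field_simp
  set a : ι → ℝ := fun i => t * p i + d i with ha
  have hwa : w = ∑ i, a i • s i := by
    simp only [ha, add_smul, Finset.sum_add_distrib, hd, mul_smul, ← Finset.smul_sum]
    abel
  have ha_lower : ∀ i, p i₀ * t / 2 ≤ a i := fun i => by
    have := neg_le_of_abs_le (hdb' i)
    have := mul_le_mul_of_nonneg_left (hi₀ i) (by linarith : 0 ≤ t)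
    simp only [ha]; linarith
  have ha_upper : ∀ i, a i ≤ 2 * P * t := fun i => by
    have := le_of_abs_le (hdb' i)
    have := mul_le_mul_of_nonneg_left (hpP i) (by linarith : 0 ≤ t)
    have := mul_le_mul_of_nonneg_left (hpP i₀) (by linarith : 0 ≤ t)
    have : 0 ≤ P * t := mul_nonneg (hp₀.le.trans (hpP i₀)) (by linarith)
    simp only [ha]; linarith
  have hρ : w - ∑ i, ⌊a i⌋ • s i = ∑ i, Int.fract (a i) • s i := by
    rw [hwa, ← Finset.sum_sub_distrib]
    refine Finset.sum_congr rfl fun i _ => ?_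
    rw [← Int.cast_smul_eq_zsmul ℝ, ← sub_smul, Int.self_sub_floor]
  obtain ⟨n, hn, hnN⟩ := hN (w - ∑ i, ⌊a i⌋ • s i)
    (Submodule.sub_mem _ hw (Submodule.sum_mem _ fun i _ => Submodule.smul_mem _ _ (hsmem i)))
    (by
      rw [hρ]
      refine (norm_sum_le _ _).trans (Finset.sum_le_sum fun i _ => ?_)
      rw [norm_smul, Real.norm_of_nonneg (Int.fract_nonneg _)]
      exact mul_le_of_le_one_left (norm_nonneg _) (Int.fract_lt_one _).le)
  have hnR : ∀ i, |(n i : ℝ)| ≤ N := fun i => by exact_mod_cast hnN i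
  have hk : ∀ i, 1 ≤ ⌊a i⌋ + n i := fun i => by
    have h1 := Int.lt_floor_add_one (a i)
    have h2 := neg_le_of_abs_le (hnR i)
    have h3 := ha_lower i
    have : (0 : ℝ) < ((⌊a i⌋ + n i : ℤ) : ℝ) := by push_cast; linarith
    have : 0 < ⌊a i⌋ + n i := by exact_mod_cast this
    omega
  have hkc : ∀ i, ((⌊a i⌋ + n i).toNat : ℤ) = ⌊a i⌋ + n i := fun i =>
    Int.toNat_of_nonneg (by linarith [hk i])
  have hkle : ∀ i, ((⌊a i⌋ + n i).toNat : ℝ) ≤ (2 * P + N) * t := fun i => by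
    have h0 : (((⌊a i⌋ + n i).toNat : ℤ) : ℝ) = ⌊a i⌋ + n i := by rw [hkc]; push_cast; rfl
    have h1 := Int.floor_le (a i)
    have h2 := le_of_abs_le (hnR i)
    have h3 := ha_upper i
    have h4 : (N : ℝ) ≤ N * t := le_mul_of_one_le_right (by positivity) ht1
    push_cast at h0
    rw [h0]
    linarith
  have hwk : w = ∑ i, (⌊a i⌋ + n i).toNat • s i := by
    have : w = ∑ i, ⌊a i⌋ • s i + ∑ i, n i • s i := by rw [hn]; abel
    rw [this, ← Finset.sum_add_distrib]
    refine Finset.sum_congr rfl fun i _ => ?_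
    rw [← natCast_zsmul, hkc, add_smul]
  have key := S.sum_nsmul_mem_and_le f hsub s hs (fun i => (⌊a i⌋ + n i).toNat)
    (fun i => by have := hk i; omega)
  rw [← hwk] at key
  refine ⟨key.1, key.2.trans ?_⟩
  rw [mul_right_comm, Finset.mul_sum]
  refine Finset.sum_le_sum fun i _ => ?_
  calc ((⌊a i⌋ + n i).toNat : ℝ) * f (s i) ≤ (⌊a i⌋ + n i).toNat * |f (s i)| := by
        gcongr; exact le_abs_self _
    _ ≤ _ := by gcongr; exact hkle i

/-- From a relative interior point of a convex set containing `0` and `e`, one may move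
slightly in the direction `-e`. -/
theorem exists_sub_smul_mem_of_mem_intrinsicInterior {V : Type*} [NormedAddCommGroup V]
    [NormedSpace ℝ V] {C : Set V} {x e : V} (hx : x ∈ intrinsicInterior ℝ C)
    (h0 : (0 : V) ∈ C) (he : e ∈ C) : ∃ τ > (0 : ℝ), x - τ • e ∈ C := by
  obtain ⟨z, hz, rfl⟩ := mem_intrinsicInterior.1 hx
  have hmem : ∀ τ : ℝ, (z : V) - τ • e ∈ affineSpan ℝ C := fun τ => by
    have := AffineSubspace.smul_vsub_vadd_mem (affineSpan ℝ C) τ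
      (subset_affineSpan ℝ C h0) (subset_affineSpan ℝ C he) z.2
    simpa [sub_eq_neg_add] using this
  let φ : ℝ → affineSpan ℝ C := fun τ => ⟨z - τ • e, hmem τ⟩
  have hφ : Continuous φ := by fun_prop
  have hφ0 : φ 0 = z := by ext; simp [φ]
  have hev : ∀ᶠ τ in nhdsWithin (0 : ℝ) (Set.Ioi 0), (z : V) - τ • e ∈ C := by
    refine nhdsWithin_le_nhds ?_
    have : φ ⁻¹' interior ((↑) ⁻¹' C) ∈ nhds 0 :=
      (isOpen_interior.preimage hφ).mem_nhds (by simpa [hφ0] using hz)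
    filter_upwards [this] with τ hτ
    have hτC : φ τ ∈ ((↑) ⁻¹' C : Set (affineSpan ℝ C)) := interior_subset hτ
    exact hτC
  obtain ⟨τ, hτ, hτ0⟩ := (hev.and self_mem_nhdsWithin).exists
  exact ⟨τ, hτ0, hτ⟩

/-- A relative interior point of the closed cone over `S` is a positive combination of finitely
many elements of `S` that generate the group `ℤS`. -/
theorem exists_pos_combination.{u} {V : Type u} [NormedAddCommGroup V] [NormedSpace ℝ V]
    [FiniteDimensional ℝ V] (S : AddSubsemigroup V) (hSne : (S : Set V).Nonempty)
    [DiscreteTopology (Submodule.span ℤ (S : Set V))] (x : V)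
    (hx : x ∈ intrinsicInterior ℝ (closure (convexHull ℝ
      {y : V | ∃ t : ℝ, 0 ≤ t ∧ ∃ s ∈ S, y = t • s}))) :
    ∃ (ι : Type u) (_ : Fintype ι) (_ : Nonempty ι) (s : ι → V) (p : ι → ℝ),
      (∀ i, s i ∈ S) ∧ Submodule.span ℤ (Set.range s) = Submodule.span ℤ (S : Set V) ∧
      (∀ i, 0 < p i) ∧ ∑ i, p i • s i = x := by
  classical
  obtain ⟨s₀, hs₀⟩ := hSne
  set C₀ := {y : V | ∃ t : ℝ, 0 ≤ t ∧ ∃ s ∈ S, y = t • s}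
  have hsubC : C₀ ⊆ closure (convexHull ℝ C₀) := (subset_convexHull ℝ _).trans subset_closure
  have hfg : (Submodule.span ℤ (S : Set V)).FG :=
    Module.Finite.iff_fg.1 (instModuleFinite_of_discrete_submodule _)
  obtain ⟨F₀, hF₀S, hF₀⟩ := (Submodule.fg_span_iff_fg_span_finset_subset _).1 hfg
  let F := insert s₀ F₀
  have hFS : ∀ v ∈ F, v ∈ S := by
    intro v hv
    rcases Finset.mem_insert.1 hv with rfl | hv
    exacts [hs₀, hF₀S hv]
  have hFspan : Submodule.span ℤ (S : Set V) ≤ Submodule.span ℤ (F : Set V) := by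
    rw [hF₀]
    exact Submodule.span_mono (by simp [F])
  have : Nonempty F := ⟨⟨s₀, Finset.mem_insert_self _ _⟩⟩
  set e : V := ∑ i : F, (i : V)
  have heS : e ∈ S := by
    simpa only [one_smul] using (S.sum_nsmul_mem_and_le (fun _ => 0) (by simp) (fun i : F => (i : V))
      (fun i => hFS i i.2) (fun _ => 1) (fun _ => le_rfl)).1
  obtain ⟨τ, hτ, hy⟩ := exists_sub_smul_mem_of_mem_intrinsicInterior hx
    (hsubC ⟨0, le_rfl, s₀, hs₀, by simp⟩) (hsubC ⟨1, zero_le_one, e, heS, (one_smul ℝ e).symm⟩)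
  obtain ⟨M, hM, hcoef⟩ := exists_bounded_coefficients (fun i : F => (i : V))
  obtain ⟨y, hyC, hyx⟩ := Metric.mem_closure_iff.1 hy (τ / M) (by positivity)
  have hspanF : Submodule.span ℝ (Set.range fun i : F => (i : V)) =
      Submodule.span ℝ (F : Set V) := by
    congr 1; ext; simp
  have hSR : ∀ v ∈ S, v ∈ Submodule.span ℝ (F : Set V) := fun v hv =>
    Submodule.span_le_restrictScalars ℤ ℝ _ (hFspan (Submodule.subset_span hv))
  have hC₀R : convexHull ℝ C₀ ⊆ Submodule.span ℝ (F : Set V) :=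
    convexHull_min (by rintro _ ⟨t, -, s, hs, rfl⟩; exact Submodule.smul_mem _ _ (hSR s hs))
      (Submodule.convex _)
  have hCR : closure (convexHull ℝ C₀) ⊆ Submodule.span ℝ (F : Set V) :=
    closure_minimal hC₀R (Submodule.closed_of_finiteDimensional _)
  obtain ⟨d, hd, hdb⟩ := hcoef (x - τ • e - y) (by
    rw [hspanF]
    exact Submodule.sub_mem _ (hCR hy) (hC₀R hyC))
  have hdτ : ∀ i, 0 < τ + d i := fun i => by
    have h : M * ‖x - τ • e - y‖ < τ := by
      rw [dist_eq_norm, lt_div_iff₀ hM] at hyx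
      linarith
    linarith [neg_le_of_abs_le (hdb i)]
  have hyK : y ∈ Submodule.span NNReal (S : Set V) := by
    have : convexHull ℝ C₀ ⊆ (Submodule.span NNReal (S : Set V) : Set V) := by
      refine convexHull_min ?_ (PointedCone.convex (Submodule.span NNReal (S : Set V)))
      rintro _ ⟨t, ht, s, hs, rfl⟩
      exact Submodule.smul_mem _ (⟨t, ht⟩ : NNReal) (Submodule.subset_span hs)
    exact this hyC
  obtain ⟨c, hcS, hc⟩ := Submodule.mem_span_set.1 hyK
  refine ⟨F ⊕ c.support, inferInstance, inferInstance, Sum.elim (fun i => i) (fun i => i),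
    Sum.elim (fun i => τ + d i) (fun i => c i), ?_, ?_, ?_, ?_⟩
  · rintro (i | i)
    exacts [hFS i i.2, hcS i.2]
  · refine le_antisymm (Submodule.span_mono ?_) (hFspan.trans (Submodule.span_mono ?_))
    · rintro _ ⟨i | i, rfl⟩
      exacts [hFS i i.2, hcS i.2]
    · exact fun v hv => ⟨Sum.inl ⟨v, hv⟩, rfl⟩
  · rintro (i | i)
    · exact hdτ i
    · have := Finsupp.mem_support_iff.1 i.2
      simpa using pos_iff_ne_zero.2 this
  · have hcy : ∑ i : c.support, (c i : ℝ) • (i : V) = y := by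
      rw [← hc]
      exact Finset.sum_coe_sort c.support fun v => (c v : ℝ) • v
    simp only [Fintype.sum_sum_type, Sum.elim_inl, Sum.elim_inr, add_smul,
      Finset.sum_add_distrib, hd, hcy, ← Finset.smul_sum]
    abel

/-- Comparison of two sequences rescaling to `x`: a bound holding frequently along one of them
holds, up to an arbitrarily small error, eventually along the other. -/
theorem eventually_mul_lt_of_frequently_mul_lt {V : Type*} [NormedAddCommGroup V]
    [NormedSpace ℝ V] (S : AddSubsemigroup V)
    (f : V → ℝ) (hsub : ∀ u ∈ S, ∀ v ∈ S, f (u + v) ≤ f u + f v) {x : V} {r A T : ℝ} (hr : 0 < r)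
    (hray : ∀ w ∈ Submodule.span ℤ (S : Set V), ∀ t ≥ T, ‖w - t • x‖ ≤ r * t →
      w ∈ S ∧ f w ≤ A * t)
    {ε δ : ℕ → ℝ} {u v : ℕ → V} (hε : ∀ k, 0 < ε k) (hε0 : Tendsto ε atTop (nhds 0))
    (hu : ∀ k, u k ∈ S) (hux : Tendsto (fun k => ε k • u k) atTop (nhds x))
    (hδ : ∀ k, 0 < δ k) (hv : ∀ k, v k ∈ S)
    (hvx : Tendsto (fun k => δ k • v k) atTop (nhds x)) {c c' : ℝ} (hcc' : c < c')
    (hfreq : ∃ᶠ j in atTop, δ j * f (v j) < c) :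
    ∀ᶠ k in atTop, ε k * f (u k) < c' := by
  obtain ⟨η, hηc, hη0, hη1⟩ : ∃ η : ℝ, (1 - η) * c + A * η < c' ∧ 0 < η ∧ η < 1 := by
    have hlim : Tendsto (fun η : ℝ => (1 - η) * c + A * η) (nhdsWithin 0 (Set.Ioi 0))
        (nhds c) := by
      have : Continuous fun η : ℝ => (1 - η) * c + A * η := by fun_prop
      simpa using (this.tendsto 0).mono_left nhdsWithin_le_nhds
    obtain ⟨η, h1, h2⟩ := ((hlim.eventually_lt_const hcc').and
      (Ioo_mem_nhdsGT (zero_lt_one' ℝ))).exists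
    exact ⟨η, h1, h2⟩
  have hnear : ∀ᶠ j in atTop, ‖x - δ j • v j‖ < r * η := by
    have : Tendsto (fun j => ‖x - δ j • v j‖) atTop (nhds 0) := by
      simpa using (hvx.const_sub x).norm
    exact this.eventually_lt_const (by positivity)
  obtain ⟨j, hjc, hjx⟩ := (hfreq.and_eventually hnear).exists
  have hinv : Tendsto (fun k => (ε k)⁻¹) atTop atTop :=
    tendsto_inv_nhdsGT_zero.comp (tendsto_nhdsWithin_iff.2 ⟨hε0, Eventually.of_forall hε⟩)
  set m : ℕ → ℕ := fun k => ⌊(1 - η) * δ j * (ε k)⁻¹⌋₊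
  have hm : Tendsto (fun k => ε k * m k) atTop (nhds ((1 - η) * δ j)) := by
    refine ((tendsto_nat_floor_mul_div_atTop
      (mul_nonneg (by linarith) (hδ j).le)).comp hinv).congr fun k => ?_
    simp [m, div_eq_mul_inv, mul_comm]
  have hw : Tendsto (fun k => ‖ε k • u k - (ε k * m k) • v j - η • x‖) atTop
      (nhds ‖x - ((1 - η) * δ j) • v j - η • x‖) :=
    ((hux.sub (hm.smul_const _)).sub_const _).norm
  have hlt : ‖x - ((1 - η) * δ j) • v j - η • x‖ < r * η := by
    have : x - ((1 - η) * δ j) • v j - η • x = (1 - η) • (x - δ j • v j) := by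
      module
    rw [this, norm_smul, Real.norm_of_nonneg (by linarith)]
    exact (mul_le_of_le_one_left (norm_nonneg _) (by linarith)).trans_lt hjx
  have hbound : Tendsto (fun k => ε k * m k * f (v j) + A * η) atTop
      (nhds ((1 - η) * δ j * f (v j) + A * η)) := (hm.mul_const _).add_const _
  have hlt' : (1 - η) * δ j * f (v j) + A * η < c' := by
    refine lt_of_le_of_lt ?_ hηc
    rw [mul_assoc]
    gcongr
  filter_upwards [hw.eventually_lt_const hlt, hbound.eventually_lt_const hlt',
    (hinv.const_mul_atTop hη0).eventually_ge_atTop T] with k hk1 hk2 hk3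
  have hεk := hε k
  obtain ⟨hwS, hfw⟩ := hray (u k - m k • v j)
    (Submodule.sub_mem _ (Submodule.subset_span (hu k))
      (nsmul_mem (Submodule.subset_span (hv j)) _)) (η * (ε k)⁻¹) hk3 (by
      have h : u k - m k • v j - (η * (ε k)⁻¹) • x =
          (ε k)⁻¹ • (ε k • u k - (ε k * m k) • v j - η • x) := by
        rw [smul_sub, smul_sub, smul_smul, smul_smul, smul_smul, inv_mul_cancel₀ hεk.ne',
          one_smul, inv_mul_cancel_left₀ hεk.ne', Nat.cast_smul_eq_nsmul, mul_comm η]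
      rw [h, norm_smul, Real.norm_of_nonneg (by positivity), ← mul_assoc, mul_comm]
      gcongr)
  have hfu := S.nsmul_add_le f hsub (hv j) hwS (m k)
  rw [add_sub_cancel] at hfu
  calc ε k * f (u k) ≤ ε k * (m k * f (v j) + A * (η * (ε k)⁻¹)) := by gcongr; linarith
    _ = ε k * m k * f (v j) + A * η := by field_simp
    _ < c' := hk2

open Filter

/-- Witt-Nyström's several-variable Fekete lemma: let `S` be a discrete
subsemigroup of a finite-dimensional real vector space (the subgroup `ℤS`
generated by `S` is discrete), `f : S → ℝ` subadditive, and `x` a point of the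
relative interior of the closed convex cone generated by `S`.  Then for every
sequence `ε_k > 0`, `ε_k → 0`, `u_k ∈ S` with `ε_k • u_k → x`, the limit
`lim ε_k f(u_k)` exists in `ℝ ∪ {-∞}` (i.e. in `EReal`, never `+∞`) and
depends only on `x`. -/
theorem wittNystrom_fekete {V : Type} [NormedAddCommGroup V] [NormedSpace ℝ V]
    [FiniteDimensional ℝ V]
    (S : AddSubsemigroup V) (hSne : (S : Set V).Nonempty)
    (hdisc : DiscreteTopology (AddSubgroup.closure (S : Set V)))
    (f : V → ℝ) (hsub : ∀ u ∈ S, ∀ v ∈ S, f (u + v) ≤ f u + f v)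
    (x : V)
    (hx : x ∈ intrinsicInterior ℝ (closure (convexHull ℝ
      {y : V | ∃ t : ℝ, 0 ≤ t ∧ ∃ s ∈ S, y = t • s}))) :
    ∃ L : EReal, L ≠ ⊤ ∧
      ∀ (ε : ℕ → ℝ) (u : ℕ → V), (∀ k, 0 < ε k) →
        Tendsto ε atTop (nhds 0) → (∀ k, u k ∈ S) →
        Tendsto (fun k => ε k • u k) atTop (nhds x) →
        Tendsto (fun k => ((ε k * f (u k) : ℝ) : EReal)) atTop (nhds L) := by
  have hspan : (Submodule.span ℤ (S : Set V)).toAddSubgroup = AddSubgroup.closure (S : Set V) :=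
    Submodule.span_int_eq_addSubgroupClosure _
  have hdiscZ : DiscreteTopology (Submodule.span ℤ (S : Set V)) := by
    rw [← hspan] at hdisc
    exact hdisc
  obtain ⟨ι, _, _, s, p, hs, hspanS, hp, rfl⟩ := exists_pos_combination S hSne x hx
  have : DiscreteTopology (Submodule.span ℤ (Set.range s)) := by rwa [hspanS]
  obtain ⟨r, hr, A, T, hray⟩ := exists_mem_and_le_of_near_ray S f hsub s hs p hp
  rw [hspanS] at hray
  set x := ∑ i, p i • s i
  have hcompare : ∀ (ε δ : ℕ → ℝ) (u v : ℕ → V), (∀ k, 0 < ε k) → Tendsto ε atTop (nhds 0) →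
      (∀ k, u k ∈ S) → Tendsto (fun k => ε k • u k) atTop (nhds x) → (∀ k, 0 < δ k) →
      (∀ k, v k ∈ S) → Tendsto (fun k => δ k • v k) atTop (nhds x) →
      limsup (fun k => ((ε k * f (u k) : ℝ) : EReal)) atTop ≤
        liminf (fun k => ((δ k * f (v k) : ℝ) : EReal)) atTop := by
    intro ε δ u v hε hε0 hu hux hδ hv hvx
    refine EReal.le_of_forall_lt_iff_le.1 fun c' hc' => ?_
    obtain ⟨c, hc, hcc'⟩ := EReal.lt_iff_exists_real_btwn.1 hc'
    refine limsup_le_of_le (by isBoundedDefault) ?_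
    have hfreq := frequently_lt_of_liminf_lt (by isBoundedDefault) hc
    filter_upwards [eventually_mul_lt_of_frequently_mul_lt S f hsub hr hray hε hε0 hu hux hδ hv hvx
      (EReal.coe_lt_coe_iff.1 hcc') (hfreq.mono fun j hj => EReal.coe_lt_coe_iff.1 hj)] with k hk
    exact EReal.coe_le_coe_iff.2 hk.le
  by_cases hex : ∃ (δ : ℕ → ℝ) (v : ℕ → V), (∀ k, 0 < δ k) ∧ Tendsto δ atTop (nhds 0) ∧
      (∀ k, v k ∈ S) ∧ Tendsto (fun k => δ k • v k) atTop (nhds x)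
  · obtain ⟨δ, v, hδ, hδ0, hv, hvx⟩ := hex
    refine ⟨limsup (fun k => ((δ k * f (v k) : ℝ) : EReal)) atTop, ne_top_of_le_ne_top
      (EReal.coe_ne_top A) ?_, fun ε u hε hε0 hu hux => ?_⟩
    · refine limsup_le_of_le (by isBoundedDefault) ?_
      have hinv : Tendsto (fun k => (δ k)⁻¹) atTop atTop :=
        tendsto_inv_nhdsGT_zero.comp (tendsto_nhdsWithin_iff.2 ⟨hδ0, Eventually.of_forall hδ⟩)
      have hnear : Tendsto (fun k => ‖δ k • v k - x‖) atTop (nhds 0) := by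
        simpa using (hvx.sub_const x).norm
      filter_upwards [hinv.eventually_ge_atTop T, hnear.eventually_lt_const hr] with k hkT hkr
      have hδk := hδ k
      have h := (hray (v k) (Submodule.subset_span (hv k)) _ hkT (by
        have h : v k - (δ k)⁻¹ • x = (δ k)⁻¹ • (δ k • v k - x) := by
          rw [smul_sub, inv_smul_smul₀ hδk.ne']
        rw [h, norm_smul, Real.norm_of_nonneg (by positivity), mul_comm]
        gcongr)).2
      rw [← div_eq_mul_inv, le_div_iff₀ hδk, mul_comm] at h
      exact EReal.coe_le_coe_iff.2 h
    · exact tendsto_of_le_liminf_of_limsup_le (hcompare δ ε v u hδ hδ0 hv hvx hε hu hux)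
        ((hcompare ε δ u v hε hε0 hu hux hδ hv hvx).trans liminf_le_limsup)
  · exact ⟨0, EReal.zero_ne_top, fun ε u hε hε0 hu hux => (hex ⟨ε, u, hε, hε0, hu, hux⟩).elim⟩
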